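/- arXiv:2407.13215 — 2 statements merged into one kernel-verified Lean document; each statement's English description precedes it below -/
import Mathlib

section
/- Let $d \geq 3$, $\kappa \in (2,d)$, and let $R : \mathbb{R}^d \to \mathbb{R}$ satisfy $0 \le R(x) \le C(1+|x|)^{-\kappa}$. Then there is a constant $C' > 0$ such that for all $x \in \mathbb{R}^d \setminus \{0\}$, $\int_0^\infty \int_{\mathbb{R}^d} P_r(z-x) R(z)\,dz\,dr \le C' \min(1, |x|^{2-\kappa})$. -/
open MeasureTheory Real Set

noncomputable def heatKernel (d : ℕ) (t : ℝ) (x : EuclideanSpace ℝ (Fin d)) : ℝ :=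
  (2 * Real.pi * t) ^ (-(d : ℝ) / 2) * Real.exp (-‖x‖ ^ 2 / (2 * t))

lemma hk_nonneg (d : ℕ) (r : ℝ) (hr : 0 < r) (x : EuclideanSpace ℝ (Fin d)) :
    0 ≤ heatKernel d r x := by
  unfold heatKernel; positivity

lemma hk_eq (d : ℕ) (r : ℝ) (hr : 0 < r) :
    heatKernel d r = fun x => (2 * Real.pi * r) ^ (-(d : ℝ) / 2) *
      Real.exp (-(1 / (2 * r)) * ‖x‖ ^ 2) := by
  funext x
  unfold heatKernel
  congr 2
  field_simp

lemma hk_integral (d : ℕ) (r : ℝ) (hr : 0 < r) :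
    ∫ x, heatKernel d r x = 1 := by
  rw [hk_eq d r hr, integral_const_mul,
    GaussianFourier.integral_rexp_neg_mul_sq_norm (by positivity)]
  have : π / (1 / (2 * r)) = 2 * π * r := by field_simp
  rw [this, ← Real.rpow_add (by positivity)]
  simp
  convert Real.rpow_zero _ using 2
  ring

lemma hk_integrable (d : ℕ) (r : ℝ) (hr : 0 < r) : Integrable (heatKernel d r) := by
  by_contra h
  have := hk_integral d r hr
  rw [integral_undef h] at this
  norm_num at this

lemma hk_integral_sub (d : ℕ) (r : ℝ) (hr : 0 < r) (x : EuclideanSpace ℝ (Fin d)) :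
    ∫ z, heatKernel d r (z - x) = 1 := by
  rw [integral_sub_right_eq_self (heatKernel d r) x, hk_integral d r hr]

lemma ball_rad (d : ℕ) (hd : 3 ≤ d) (κ : ℝ) (hκ : κ < d) : ∃ K : ℝ, 0 ≤ K ∧
    ∀ ρ : ℝ, 0 < ρ →
      Integrable (fun z : EuclideanSpace ℝ (Fin d) => (Iio ρ).indicator (fun y : ℝ => y ^ (-κ)) ‖z‖) ∧
      ∫ z : EuclideanSpace ℝ (Fin d), (Iio ρ).indicator (fun y : ℝ => y ^ (-κ)) ‖z‖
        = K * ρ ^ ((d : ℝ) - κ) := by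
  have : Nonempty (Fin d) := ⟨⟨0, by omega⟩⟩
  refine ⟨d * (volume : Measure (EuclideanSpace ℝ (Fin d))).real (Metric.ball 0 1) * (1 / (d - κ)),
    ?_, ?_⟩
  · have : 0 < (d : ℝ) - κ := by linarith
    positivity
  intro ρ hρ
  have e : EqOn (fun y : ℝ => y ^ (Module.finrank ℝ (EuclideanSpace ℝ (Fin d)) - 1) •
      (Iio ρ).indicator (fun y : ℝ => y ^ (-κ)) y)
      ((Iio ρ).indicator (fun y : ℝ => y ^ ((d : ℝ) - 1 - κ))) (Ioi 0) := by
    intro y hy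
    have hy : 0 < y := hy
    by_cases h : y ∈ Iio ρ
    · simp only [h, indicator_of_mem, finrank_euclideanSpace_fin, smul_eq_mul]
      rw [← Real.rpow_natCast, ← Real.rpow_add hy, Nat.cast_sub (by omega)]
      congr 1
      push_cast
      ring
    · simp [h]
  have e2 : Iio ρ ∩ Ioi 0 = Ioo 0 ρ := by
    ext; simp [and_comm]
  constructor
  · rw [integrable_fun_norm_addHaar (volume : Measure (EuclideanSpace ℝ (Fin d)))
      (f := (Iio ρ).indicator (fun y : ℝ => y ^ (-κ)))]
    rw [integrableOn_congr_fun e measurableSet_Ioi, IntegrableOn,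
      integrable_indicator_iff measurableSet_Iio, IntegrableOn, Measure.restrict_restrict measurableSet_Iio, e2]
    exact (intervalIntegral.integrableOn_Ioo_rpow_iff hρ).2 (by linarith)
  · rw [integral_fun_norm_addHaar (volume : Measure (EuclideanSpace ℝ (Fin d)))
      ((Iio ρ).indicator (fun y : ℝ => y ^ (-κ)))]
    rw [setIntegral_congr_fun measurableSet_Ioi e, integral_indicator measurableSet_Iio,
      Measure.restrict_restrict measurableSet_Iio, e2, ← integral_Ioc_eq_integral_Ioo,
      ← intervalIntegral.integral_of_le hρ.le, integral_rpow (Or.inl (by linarith))]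
    have : (d : ℝ) - 1 - κ + 1 = d - κ := by ring
    rw [this, Real.zero_rpow (by linarith)]
    simp
    ring

lemma key (d : ℕ) (hd : 3 ≤ d) (κ : ℝ) (hκ0 : 0 < κ) (hκ : κ < d) (M : ℝ) (hM : 0 ≤ M) :
    ∃ N : ℝ, 0 < N ∧ ∀ (R : EuclideanSpace ℝ (Fin d) → ℝ) (C : ℝ) (_ : 0 ≤ C)
    (_ : ∀ x, 0 ≤ R x ∧ R x ≤ C * (1 + ‖x‖) ^ (-κ)) (x : EuclideanSpace ℝ (Fin d)) (r ρ : ℝ),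
    0 < r → 0 < ρ → (∀ z : EuclideanSpace ℝ (Fin d), ‖z‖ < ρ →
      heatKernel d r (z - x) ≤ M * ρ ^ (-(d : ℝ))) →
    ∫ z, heatKernel d r (z - x) * R z ≤ C * N * ρ ^ (-κ) := by
  have : Nonempty (Fin d) := ⟨⟨0, by omega⟩⟩
  obtain ⟨K, hK, H⟩ := ball_rad d hd κ hκ
  refine ⟨1 + M * K, by positivity, ?_⟩
  intro R C hC hR x r ρ hr hρ hP
  obtain ⟨hi, hI⟩ := H ρ hρ
  have i1 : Integrable (fun z => heatKernel d r (z - x)) := (hk_integrable d r hr).comp_sub_right x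
  have main : ∫ z, heatKernel d r (z - x) * R z ≤ ∫ z, (C * ρ ^ (-κ) * heatKernel d r (z - x) +
      C * (M * ρ ^ (-(d : ℝ))) * (Iio ρ).indicator (fun y : ℝ => y ^ (-κ)) ‖z‖) := by
    apply integral_mono_of_nonneg
    · exact Filter.Eventually.of_forall fun z => mul_nonneg (hk_nonneg d r hr _) (hR z).1
    · exact (i1.const_mul _).add (hi.const_mul _)
    · have h0 : ∀ᵐ z : EuclideanSpace ℝ (Fin d), z ≠ 0 :=
        compl_mem_ae_iff.2 (measure_singleton 0)
      filter_upwards [h0] with z hz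
      have hz' : 0 < ‖z‖ := norm_pos_iff.2 hz
      have hk := hk_nonneg d r hr (z - x)
      by_cases h : ‖z‖ < ρ
      · rw [indicator_of_mem (by exact h)]
        have a : R z ≤ C * ‖z‖ ^ (-κ) := (hR z).2.trans
          (mul_le_mul_of_nonneg_left
            (Real.rpow_le_rpow_of_nonpos hz' (by linarith) (by linarith)) hC)
        have : heatKernel d r (z - x) * R z ≤ (M * ρ ^ (-(d : ℝ))) * (C * ‖z‖ ^ (-κ)) :=
          mul_le_mul (hP z h) a (hR z).1 (by positivity)
        have : 0 ≤ C * ρ ^ (-κ) * heatKernel d r (z - x) := by positivity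
        linarith
      · rw [indicator_of_notMem (by exact h)]
        have a : R z ≤ C * ρ ^ (-κ) := (hR z).2.trans
          (mul_le_mul_of_nonneg_left
            (Real.rpow_le_rpow_of_nonpos hρ (by linarith) (by linarith)) hC)
        have := mul_le_mul_of_nonneg_left a hk
        linarith
  refine main.trans (le_of_eq ?_)
  rw [integral_add (i1.const_mul _) (hi.const_mul _), integral_const_mul, integral_const_mul,
    hk_integral_sub d r hr, hI]
  have : ρ ^ (-(d : ℝ)) * ρ ^ ((d : ℝ) - κ) = ρ ^ (-κ) := by
    rw [← Real.rpow_add hρ]; congr 1; ring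
  linear_combination C * M * K * this

lemma bound0 (d : ℕ) (κ : ℝ) (hκ0 : 0 < κ)
    (R : EuclideanSpace ℝ (Fin d) → ℝ) (C : ℝ) (hC : 0 ≤ C)
    (hR : ∀ x, 0 ≤ R x ∧ R x ≤ C * (1 + ‖x‖) ^ (-κ)) (x : EuclideanSpace ℝ (Fin d)) (r : ℝ)
    (hr : 0 < r) : ∫ z, heatKernel d r (z - x) * R z ≤ C := by
  have i1 : Integrable (fun z => heatKernel d r (z - x)) := (hk_integrable d r hr).comp_sub_right x
  have main : ∫ z, heatKernel d r (z - x) * R z ≤ ∫ z, C * heatKernel d r (z - x) := by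
    apply integral_mono_of_nonneg
    · exact Filter.Eventually.of_forall fun z => mul_nonneg (hk_nonneg d r hr _) (hR z).1
    · exact (i1.const_mul _)
    · refine Filter.Eventually.of_forall fun z => ?_
      have hk := hk_nonneg d r hr (z - x)
      have a : R z ≤ C * 1 := (hR z).2.trans (mul_le_mul_of_nonneg_left
        (Real.rpow_le_one_of_one_le_of_nonpos (by linarith [norm_nonneg z]) (by linarith)) hC)
      have := mul_le_mul_of_nonneg_left a hk
      simp only
      linarith
  rwa [integral_const_mul, hk_integral_sub d r hr, mul_one] at main

lemma hk_time (d : ℕ) (hd : 3 ≤ d) (r : ℝ) (hr : 0 < r) (x : EuclideanSpace ℝ (Fin d)) :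
    heatKernel d r x ≤ (d : ℝ) ^ ((d : ℝ) / 2) * (√r) ^ (-(d : ℝ)) := by
  have hd' : (3 : ℝ) ≤ d := by exact_mod_cast hd
  have h1 : (2 * π * r) ^ (-(d : ℝ) / 2) ≤ r ^ (-(d : ℝ) / 2) :=
    Real.rpow_le_rpow_of_nonpos hr (by nlinarith [Real.pi_gt_three]) (by linarith)
  have h2 : (√r) ^ (-(d : ℝ)) = r ^ (-(d : ℝ) / 2) := by
    rw [Real.sqrt_eq_rpow, ← Real.rpow_mul hr.le]; congr 1; ring
  have h3 : 1 ≤ (d : ℝ) ^ ((d : ℝ) / 2) := Real.one_le_rpow (by linarith) (by linarith)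
  have h4 : Real.exp (-‖x‖ ^ 2 / (2 * r)) ≤ 1 := by
    rw [Real.exp_le_one_iff, neg_div]
    have : 0 ≤ ‖x‖ ^ 2 / (2 * r) := by positivity
    linarith
  rw [h2]
  unfold heatKernel
  have h5 : 0 < r ^ (-(d : ℝ) / 2) := by positivity
  calc _ ≤ r ^ (-(d : ℝ) / 2) * 1 := mul_le_mul h1 h4 (by positivity) h5.le
    _ ≤ _ := by nlinarith

lemma hk_space (d : ℕ) (hd : 3 ≤ d) (r : ℝ) (hr : 0 < r) (ρ : ℝ) (hρ : 0 < ρ)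
    (x : EuclideanSpace ℝ (Fin d)) (hx : ρ ≤ ‖x‖) :
    heatKernel d r x ≤ (d : ℝ) ^ ((d : ℝ) / 2) * ρ ^ (-(d : ℝ)) := by
  have hd' : (3 : ℝ) ≤ d := by exact_mod_cast hd
  have hd0 : (0 : ℝ) < d := by linarith
  have h1 : (2 * π * r) ^ (-(d : ℝ) / 2) ≤ r ^ (-(d : ℝ) / 2) :=
    Real.rpow_le_rpow_of_nonpos hr (by nlinarith [Real.pi_gt_three]) (by linarith)
  have h4 : Real.exp (-‖x‖ ^ 2 / (2 * r)) ≤ (ρ ^ 2 / (r * d)) ^ (-(d : ℝ) / 2) := by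
    have a : ρ ^ 2 / (r * d) ≤ Real.exp (ρ ^ 2 / (r * d)) := by
      linarith [Real.add_one_le_exp (ρ ^ 2 / (r * d))]
    have b := Real.rpow_le_rpow_of_nonpos (by positivity) a (z := -(d : ℝ) / 2) (by linarith)
    refine le_trans ?_ b
    rw [← Real.exp_mul, Real.exp_le_exp]
    have e : ρ ^ 2 / (r * d) * (-(d : ℝ) / 2) = -ρ ^ 2 / (2 * r) := by field_simp
    rw [e]
    gcongr
  unfold heatKernel
  calc _ ≤ r ^ (-(d : ℝ) / 2) * (ρ ^ 2 / (r * d)) ^ (-(d : ℝ) / 2) :=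
        mul_le_mul h1 h4 (by positivity) (by positivity)
    _ = (d : ℝ) ^ ((d : ℝ) / 2) * ρ ^ (-(d : ℝ)) := by
      rw [← Real.mul_rpow (by positivity) (by positivity)]
      have : r * (ρ ^ 2 / (r * d)) = (d : ℝ)⁻¹ * ρ ^ 2 := by field_simp
      rw [this, Real.mul_rpow (by positivity) (by positivity), Real.inv_rpow (by positivity),
        ← Real.rpow_neg (by positivity), ← Real.rpow_natCast, ← Real.rpow_mul hρ.le]
      congr 2
      · ring
      · push_cast; ring

lemma outer (κ : ℝ) (hκ : 2 < κ) (f : ℝ → ℝ) (N A : ℝ) (hA : 0 < A)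
    (h0 : ∀ r, 0 < r → 0 ≤ f r) (h1 : ∀ r, 0 < r → f r ≤ N * A ^ (-κ))
    (h2 : ∀ r, 0 < r → f r ≤ N * r ^ (-κ / 2)) :
    ∫ r in Ioi (0 : ℝ), f r ≤ N * (1 + 2 / (κ - 2)) * A ^ (2 - κ) := by
  have hA2 : 0 < A ^ 2 := by positivity
  set g : ℝ → ℝ := fun r => if r ≤ A ^ 2 then N * A ^ (-κ) else N * r ^ (-κ / 2) with hg
  have g1 : EqOn g (fun _ => N * A ^ (-κ)) (Ioc 0 (A ^ 2)) := fun r hr => if_pos hr.2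
  have g2 : EqOn g (fun r => N * r ^ (-κ / 2)) (Ioi (A ^ 2)) := fun r hr =>
    if_neg (not_le.2 hr)
  have i1 : IntegrableOn g (Ioc 0 (A ^ 2)) := by
    rw [integrableOn_congr_fun g1 measurableSet_Ioc]
    exact integrableOn_const (by simp)
  have i2 : IntegrableOn g (Ioi (A ^ 2)) := by
    rw [integrableOn_congr_fun g2 measurableSet_Ioi]
    exact (integrableOn_Ioi_rpow_of_lt (by linarith) hA2).const_mul _
  have u : Ioc 0 (A ^ 2) ∪ Ioi (A ^ 2) = Ioi (0 : ℝ) := Ioc_union_Ioi_eq_Ioi hA2.le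
  have main : ∫ r in Ioi (0 : ℝ), f r ≤ ∫ r in Ioi (0 : ℝ), g r := by
    apply integral_mono_of_nonneg
    · filter_upwards [ae_restrict_mem measurableSet_Ioi] with r hr using h0 r hr
    · rw [← u]; exact i1.union i2
    · filter_upwards [ae_restrict_mem measurableSet_Ioi] with r hr
      simp only [hg]
      split_ifs
      · exact h1 r hr
      · exact h2 r hr
  refine main.trans (le_of_eq ?_)
  rw [← u, setIntegral_union (Ioc_disjoint_Ioi le_rfl) measurableSet_Ioi i1 i2,
    setIntegral_congr_fun measurableSet_Ioc g1, setIntegral_congr_fun measurableSet_Ioi g2,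
    setIntegral_const, integral_const_mul, integral_Ioi_rpow_of_lt (by linarith) hA2]
  have e1 : (A ^ 2 : ℝ) * A ^ (-κ) = A ^ (2 - κ) := by
    rw [← Real.rpow_natCast, ← Real.rpow_add hA]; congr 1
  have e2 : (A ^ 2 : ℝ) ^ (-κ / 2 + 1) = A ^ (2 - κ) := by
    rw [← Real.rpow_natCast, ← Real.rpow_mul hA.le]; congr 1; push_cast; ring
  rw [e2]
  have e3 : -A ^ (2 - κ) / (-κ / 2 + 1) = 2 / (κ - 2) * A ^ (2 - κ) := by
    have : κ - 2 ≠ 0 := by linarith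
    have h : -κ / 2 + 1 = -((κ - 2) / 2) := by ring
    rw [h, neg_div_neg_eq]
    field_simp
  rw [e3]
  simp [hA2.le]
  linear_combination N * e1

theorem stmt1 (d : ℕ) (hd : 3 ≤ d) (κ : ℝ) (hκ : 2 < κ ∧ κ < d)
    (R : EuclideanSpace ℝ (Fin d) → ℝ) (C : ℝ)
    (hR : ∀ x, 0 ≤ R x ∧ R x ≤ C * (1 + ‖x‖) ^ (-κ)) :
    ∃ C' > 0, ∀ x : EuclideanSpace ℝ (Fin d), x ≠ 0 →
      (∫ r in Set.Ioi (0 : ℝ), ∫ z, heatKernel d r (z - x) * R z)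
        ≤ C' * min 1 (‖x‖ ^ (2 - κ)) := by
  obtain ⟨hκ1, hκ2⟩ := hκ
  have hC : 0 ≤ C := by
    have := hR 0
    simp at this
    linarith
  obtain ⟨N, hN, H⟩ := key d hd κ (by linarith) hκ2 ((d : ℝ) ^ ((d : ℝ) / 2)) (by positivity)
  set N' : ℝ := C * (1 + N * 2 ^ κ) + 1 with hN'
  have h2κ : (1 : ℝ) ≤ 2 ^ κ := Real.one_le_rpow (by norm_num) (by linarith)
  have hk2 : 0 < κ - 2 := by linarith
  have n1 : C ≤ N' := by rw [hN']; nlinarith [mul_nonneg hC (by positivity : 0 ≤ N * 2 ^ κ)]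
  have n2 : C * N * 2 ^ κ ≤ N' := by rw [hN']; nlinarith
  have n3 : C * N ≤ N' := by nlinarith [mul_nonneg hC hN.le]
  refine ⟨N' * (1 + 2 / (κ - 2)), by positivity, fun x hx => ?_⟩
  have hx0 : 0 < ‖x‖ := norm_pos_iff.2 hx
  have h0 : ∀ r, 0 < r → 0 ≤ ∫ z, heatKernel d r (z - x) * R z := fun r hr =>
    integral_nonneg fun z => mul_nonneg (hk_nonneg d r hr _) (hR z).1
  have h2 : ∀ r, 0 < r → ∫ z, heatKernel d r (z - x) * R z ≤ N' * r ^ (-κ / 2) := by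
    intro r hr
    have := H R C hC hR x r (√r) hr (by positivity) (fun z _ => hk_time d hd r hr _)
    have e : (√r) ^ (-κ) = r ^ (-κ / 2) := by
      rw [Real.sqrt_eq_rpow, ← Real.rpow_mul hr.le]; congr 1; ring
    rw [e] at this
    exact this.trans (mul_le_mul_of_nonneg_right n3 (by positivity))
  have b1 := outer κ hκ1 _ N' 1 one_pos h0 (fun r hr => by
    have := bound0 d κ (by linarith) R C hC hR x r hr
    simp
    linarith) h2
  have b2 := outer κ hκ1 _ N' ‖x‖ hx0 h0 (fun r hr => by
    have := H R C hC hR x r (‖x‖ / 2) hr (by positivity) (fun z hz =>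
      hk_space d hd r hr _ (by positivity) _ (by
        have := norm_sub_norm_le x z
        rw [norm_sub_rev] at this
        linarith))
    refine this.trans ?_
    rw [Real.div_rpow hx0.le (by norm_num), Real.rpow_neg (by norm_num : (0:ℝ) ≤ 2)]
    have e : C * N * (‖x‖ ^ (-κ) / (2 ^ κ)⁻¹) = C * N * 2 ^ κ * ‖x‖ ^ (-κ) := by
      field_simp
    rw [e]
    exact mul_le_mul_of_nonneg_right n2 (by positivity)) h2
  rw [Real.one_rpow] at b1
  rcases min_choice 1 (‖x‖ ^ (2 - κ)) with h | h <;> rw [h]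
  · exact b1
  · exact b2
end

section
/- Let $d \geq 1$, $\kappa \in (2,d)$, and let $R : \mathbb{R}^d \to \mathbb{R}$ satisfy $0 \le R(x) \le C(1+|x|)^{-\kappa}$. Then there exists $C' > 0$ such that for all $t > 0$ and $x \in \mathbb{R}^d$, $\int_0^t \int_{\mathbb{R}^{2d}} P_r(z_1 - x) P_{t-r}(z_2) R(z_1 - z_2)\,dz_1\,dz_2\,dr \le C'\, t\,(1+|x|+\sqrt{t})^{-\kappa}$. -/
open MeasureTheory Real Set

lemma aux_gauss (d : ℕ) (b : ℝ) (hb : 0 < b) :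
    Integrable (fun z : EuclideanSpace ℝ (Fin d) => Real.exp (-b * ‖z‖ ^ 2)) := by
  have h := GaussianFourier.integrable_cexp_neg_mul_sq_norm_add
    (V := EuclideanSpace ℝ (Fin d)) (b := (b : ℂ)) (by simpa using hb) 0 0
  refine h.norm.congr (Filter.Eventually.of_forall fun z => ?_)
  simp only [Complex.norm_exp]
  congr 1
  simp [← Complex.ofReal_pow]

lemma aux_heat_int (d : ℕ) (s : ℝ) (hs : 0 < s) :
    Integrable (fun z : EuclideanSpace ℝ (Fin d) => heatKernel d s z) := by
  unfold heatKernel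
  refine ((aux_gauss d (1 / (2 * s)) (by positivity)).const_mul
    ((2 * Real.pi * s) ^ (-(d : ℝ) / 2))).congr
    (Filter.Eventually.of_forall fun z => ?_)
  simp only
  congr 2
  ring

lemma heat_nonneg (d : ℕ) (s : ℝ) (hs : 0 ≤ s) (z : EuclideanSpace ℝ (Fin d)) :
    0 ≤ heatKernel d s z := by
  unfold heatKernel
  positivity

lemma aux_int (d : ℕ) (κ : ℝ) (hκ : 0 < κ) (s a : ℝ) (hs : 0 < s) (ha : 0 < a)
    (y : EuclideanSpace ℝ (Fin d)) :
    Integrable (fun z => heatKernel d s z * (a + ‖y - z‖) ^ (-κ)) := by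
  refine (aux_heat_int d s hs).mul_bdd (c := a ^ (-κ)) ?_ ?_
  · apply Measurable.aestronglyMeasurable
    fun_prop
  · refine Filter.Eventually.of_forall fun z => ?_
    rw [Real.norm_of_nonneg (by positivity)]
    exact Real.rpow_le_rpow_of_nonpos ha (by linarith [norm_nonneg (y - z)]) (by linarith)

lemma aux_sing (d : ℕ) (hd : 1 ≤ d) (κ : ℝ) (hκ : κ < d) :
    IntegrableOn (fun u : EuclideanSpace ℝ (Fin d) => ‖u‖ ^ (-κ)) (Metric.ball 0 1) := by
  have : Nonempty (Fin d) := ⟨⟨0, hd⟩⟩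
  rw [integrableOn_fun_norm_addHaar volume (f := fun r : ℝ => r ^ (-κ))]
  have h : IntegrableOn (fun y : ℝ => y ^ ((d : ℝ) - 1 - κ)) (Ioo 0 1) := by
    rw [intervalIntegral.integrableOn_Ioo_rpow_iff one_pos]
    linarith
  refine h.congr_fun (fun y hy => ?_) measurableSet_Ioo
  simp only [finrank_euclideanSpace, Fintype.card_fin, smul_eq_mul]
  rw [← Real.rpow_natCast, ← Real.rpow_add hy.1]
  congr 1
  push_cast [Nat.cast_sub hd]
  ring

lemma aux_exp (κ : ℝ) (hκ : 0 < κ) (u : ℝ) (hu : 0 ≤ u) :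
    (1 + u) ^ κ * Real.exp (-u ^ 2 / 2) ≤ Real.exp (κ ^ 2) * Real.exp (-(1/4) * u ^ 2) := by
  have h1 : (1 + u) ^ κ ≤ Real.exp (κ * u) := by
    have : 1 + u ≤ Real.exp u := by linarith [Real.add_one_le_exp u]
    calc (1 + u) ^ κ ≤ (Real.exp u) ^ κ := Real.rpow_le_rpow (by linarith) this hκ.le
      _ = Real.exp (κ * u) := by rw [← Real.exp_mul, mul_comm]
  calc _ ≤ Real.exp (κ * u) * Real.exp (-u ^ 2 / 2) := by gcongr
    _ ≤ _ := by
      rw [← Real.exp_add, ← Real.exp_add]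
      apply Real.exp_le_exp.2
      nlinarith [sq_nonneg (κ - u / 2)]

/-- scalar pointwise bound -/
lemma aux_scalar (κ : ℝ) (hκ : 0 < κ) (b v w u : ℝ) (hb : 0 < b) (hv : 0 ≤ v) (hw : 0 ≤ w)
    (hu : 0 < u) (htri : v ≤ u + w) :
    (b + u) ^ (-κ) ≤ (b + v + 1) ^ (-κ) * (2 ^ κ * ((1 + w) ^ κ * (1 + (if u < 1 then u ^ (-κ) else 0)))) := by
  have key : (b + v + 1) ≤ (b + u) * (2 * ((1 + w) * max 1 u⁻¹)) := by
    have h1 : b + v + 1 ≤ (1 + w) * (1 + (b + u)) := by nlinarith [mul_pos hb hu, mul_nonneg hw hb.le, mul_nonneg hw hu.le]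
    have h2 : 1 + (b + u) ≤ (b + u) * (2 * max 1 u⁻¹) := by
      have : 1 ≤ (b + u) * max 1 u⁻¹ := by
        calc (1 : ℝ) = u * u⁻¹ := by field_simp
          _ ≤ (b + u) * max 1 u⁻¹ := by gcongr; linarith; exact le_max_right _ _
      have h3 : (b + u) * 1 ≤ (b + u) * max 1 u⁻¹ := by gcongr; exact le_max_left _ _
      linarith
    calc _ ≤ _ := h1
      _ ≤ (1 + w) * ((b + u) * (2 * max 1 u⁻¹)) := by gcongr
      _ = _ := by ring
  have hm : 0 < max 1 u⁻¹ := lt_max_of_lt_left one_pos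
  have h4 : (b + v + 1) ^ κ ≤ (b + u) ^ κ * (2 ^ κ * ((1 + w) ^ κ * (max 1 u⁻¹) ^ κ)) := by
    rw [← Real.mul_rpow (by positivity) hm.le, ← Real.mul_rpow (by positivity) (by positivity),
      ← Real.mul_rpow (by positivity) (by positivity)]
    exact Real.rpow_le_rpow (by positivity) key hκ.le
  have h5 : (max 1 u⁻¹) ^ κ ≤ 1 + (if u < 1 then u ^ (-κ) else 0) := by
    split_ifs with h
    · rw [max_eq_right ((one_le_inv₀ hu).2 h.le), Real.inv_rpow hu.le, Real.rpow_neg hu.le]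
      linarith
    · rw [max_eq_left (inv_le_one_of_one_le₀ (not_lt.1 h))]; simp
  have h6 : (b + v + 1) ^ κ ≤ (b + u) ^ κ * (2 ^ κ * ((1 + w) ^ κ * (1 + (if u < 1 then u ^ (-κ) else 0)))) := by
    refine h4.trans ?_
    gcongr
  rw [Real.rpow_neg (by positivity), Real.rpow_neg (by positivity)]
  rw [inv_mul_eq_div, le_div_iff₀ (by positivity), inv_mul_le_iff₀ (by positivity)]
  exact h6

lemma aux_unit (d : ℕ) (hd : 1 ≤ d) (κ : ℝ) (hκ0 : 0 < κ) (hκ : κ < d) :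
    ∃ K > 0, ∀ b > (0 : ℝ), ∀ v : EuclideanSpace ℝ (Fin d),
      ∫ w, heatKernel d 1 w * (b + ‖v - w‖) ^ (-κ) ≤ K * (b + ‖v‖ + 1) ^ (-κ) := by
  have : Nonempty (Fin d) := ⟨⟨0, hd⟩⟩
  set g : EuclideanSpace ℝ (Fin d) → ℝ := fun w => Real.exp (-(1/4) * ‖w‖ ^ 2) with hg
  set h : EuclideanSpace ℝ (Fin d) → ℝ :=
    (Metric.ball 0 1).indicator (fun u => ‖u‖ ^ (-κ)) with hh
  have hgi : Integrable g := aux_gauss d (1/4) (by norm_num)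
  have hhi : Integrable h := (integrable_indicator_iff measurableSet_ball).2 (aux_sing d hd κ hκ)
  have hg0 : 0 ≤ ∫ w, g w := integral_nonneg fun w => (Real.exp_pos _).le
  have hhn : ∀ u, 0 ≤ h u := fun u => indicator_nonneg (fun u _ => by positivity) u
  have hh0 : 0 ≤ ∫ w, h w := integral_nonneg hhn
  set A : ℝ := (2 * Real.pi * 1) ^ (-(d : ℝ) / 2) * Real.exp (κ ^ 2) * 2 ^ κ with hA
  have hA0 : 0 < A := by positivity
  refine ⟨A * ((∫ w, g w) + (∫ w, h w)) + 1, by positivity, fun b hb v => ?_⟩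
  have hhv : Integrable (fun w => h (v - w)) := hhi.comp_sub_left v
  have hB : 0 < (b + ‖v‖ + 1) ^ (-κ) := by positivity
  have hmaj : Integrable (fun w => (b + ‖v‖ + 1) ^ (-κ) * (A * (g w + h (v - w)))) :=
    ((hgi.add hhv).const_mul _).const_mul _
  calc _ ≤ ∫ w, (b + ‖v‖ + 1) ^ (-κ) * (A * (g w + h (v - w))) := by
        refine integral_mono_of_nonneg (Filter.Eventually.of_forall fun w => ?_) hmaj ?_
        · exact mul_nonneg (heat_nonneg d 1 zero_le_one w) (by positivity)
        · have hne : ∀ᵐ w : EuclideanSpace ℝ (Fin d), w ≠ v := by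
            simp [ae_iff]
          filter_upwards [hne] with w hw
          have hu : 0 < ‖v - w‖ := norm_pos_iff.2 (sub_ne_zero.2 (Ne.symm hw))
          have h1 := aux_scalar κ hκ0 b ‖v‖ ‖w‖ ‖v - w‖ hb (norm_nonneg _) (norm_nonneg _) hu
            (by simpa using norm_add_le (v - w) w)
          have h2 := aux_exp κ hκ0 ‖w‖ (norm_nonneg _)
          have h3 : (if ‖v - w‖ < 1 then ‖v - w‖ ^ (-κ) else 0) = h (v - w) := by
            simp [hh, indicator]
          rw [h3] at h1
          have hg1 : g w ≤ 1 := by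
            simp only [hg]; apply Real.exp_le_one_iff.2; nlinarith [sq_nonneg ‖w‖]
          have hhw := hhn (v - w)
          unfold heatKernel
          calc _ ≤ (2 * Real.pi * 1) ^ (-(d : ℝ) / 2) * Real.exp (-‖w‖ ^ 2 / (2 * 1)) *
                ((b + ‖v‖ + 1) ^ (-κ) * (2 ^ κ * ((1 + ‖w‖) ^ κ * (1 + h (v - w))))) := by gcongr
            _ = (b + ‖v‖ + 1) ^ (-κ) * ((2 * Real.pi * 1) ^ (-(d : ℝ) / 2) * 2 ^ κ *
                (((1 + ‖w‖) ^ κ * Real.exp (-‖w‖ ^ 2 / 2)) * (1 + h (v - w)))) := by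
                  rw [mul_one 2]; ring
            _ ≤ (b + ‖v‖ + 1) ^ (-κ) * ((2 * Real.pi * 1) ^ (-(d : ℝ) / 2) * 2 ^ κ *
                ((Real.exp (κ ^ 2) * g w) * (1 + h (v - w)))) := by gcongr
            _ = (b + ‖v‖ + 1) ^ (-κ) * (A * (g w + g w * h (v - w))) := by rw [hA]; ring
            _ ≤ _ := by
              gcongr
              nlinarith
    _ = (b + ‖v‖ + 1) ^ (-κ) * (A * ((∫ w, g w) + (∫ w, h w))) := by
        rw [integral_const_mul, integral_const_mul, integral_add hgi hhv,
          integral_sub_left_eq_self h volume v]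
    _ ≤ _ := by nlinarith

lemma heat_scale (d : ℕ) (s : ℝ) (hs : 0 < s) (w : EuclideanSpace ℝ (Fin d)) :
    heatKernel d s (Real.sqrt s • w) = (Real.sqrt s ^ d)⁻¹ * heatKernel d 1 w := by
  have hq : 0 < Real.sqrt s := Real.sqrt_pos.2 hs
  unfold heatKernel
  rw [norm_smul, mul_pow, Real.norm_of_nonneg hq.le, Real.sq_sqrt hs.le,
    Real.mul_rpow (by positivity) hs.le, mul_one, mul_one]
  have h1 : s ^ (-(d : ℝ) / 2) = (Real.sqrt s ^ d)⁻¹ := by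
    rw [Real.sqrt_eq_rpow, ← Real.rpow_natCast, ← Real.rpow_mul hs.le, ← Real.rpow_neg hs.le]
    congr 1; ring
  have h2 : -(s * ‖w‖ ^ 2) / (2 * s) = -‖w‖ ^ 2 / 2 := by field_simp
  rw [h1, h2]; ring

lemma aux_main (d : ℕ) (hd : 1 ≤ d) (κ : ℝ) (hκ0 : 0 < κ) (hκ : κ < d) :
    ∃ K > 0, ∀ s > (0 : ℝ), ∀ a > (0 : ℝ), ∀ y : EuclideanSpace ℝ (Fin d),
      ∫ z, heatKernel d s z * (a + ‖y - z‖) ^ (-κ) ≤ K * (a + ‖y‖ + Real.sqrt s) ^ (-κ) := by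
  obtain ⟨K, hK, H⟩ := aux_unit d hd κ hκ0 hκ
  refine ⟨K, hK, fun s hs a ha y => ?_⟩
  set c := Real.sqrt s with hc
  have hq : 0 < c := Real.sqrt_pos.2 hs
  have h1 := H (a / c) (by positivity) (c⁻¹ • y)
  have h2 := Measure.integral_comp_smul volume
    (fun z : EuclideanSpace ℝ (Fin d) => heatKernel d s z * (a + ‖y - z‖) ^ (-κ)) c
  have h3 : ∀ w : EuclideanSpace ℝ (Fin d),
      heatKernel d s (c • w) * (a + ‖y - c • w‖) ^ (-κ)
        = ((c ^ d)⁻¹ * c ^ (-κ)) * (heatKernel d 1 w * (a / c + ‖c⁻¹ • y - w‖) ^ (-κ)) := by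
    intro w
    have : a + ‖y - c • w‖ = c * (a / c + ‖c⁻¹ • y - w‖) := by
      have e : y - c • w = c • (c⁻¹ • y - w) := by
        rw [smul_sub, smul_smul, mul_inv_cancel₀ hq.ne', one_smul]
      rw [e, norm_smul, Real.norm_of_nonneg hq.le]
      field_simp
    rw [this, Real.mul_rpow hq.le (by positivity), heat_scale d s hs]
    ring
  simp only [h3, finrank_euclideanSpace, Fintype.card_fin, smul_eq_mul] at h2
  rw [integral_const_mul, abs_of_pos (by positivity), mul_assoc] at h2
  have h4 := mul_left_cancel₀ (by positivity) h2
  rw [← h4]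
  have h5 : a + ‖y‖ + c = c * (a / c + ‖c⁻¹ • y‖ + 1) := by
    rw [norm_smul, norm_inv, Real.norm_of_nonneg hq.le]
    field_simp
  rw [h5, Real.mul_rpow hq.le (by positivity)]
  calc _ ≤ c ^ (-κ) * (K * (a / c + ‖c⁻¹ • y‖ + 1) ^ (-κ)) := by gcongr
    _ = _ := by ring

theorem stmt2 (d : ℕ) (hd : 1 ≤ d) (κ : ℝ) (hκ : 2 < κ ∧ κ < d)
    (R : EuclideanSpace ℝ (Fin d) → ℝ) (C : ℝ)
    (hR : ∀ x, 0 ≤ R x ∧ R x ≤ C * (1 + ‖x‖) ^ (-κ)) :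
    ∃ C' > 0, ∀ t > (0 : ℝ), ∀ x : EuclideanSpace ℝ (Fin d),
      (∫ r in Set.Ioc (0 : ℝ) t, ∫ z₁, ∫ z₂,
          heatKernel d r (z₁ - x) * heatKernel d (t - r) z₂ * R (z₁ - z₂))
        ≤ C' * t * (1 + ‖x‖ + Real.sqrt t) ^ (-κ) := by
  have hκ0 : 0 < κ := by linarith [hκ.1]
  obtain ⟨K, hK, H⟩ := aux_main d hd κ hκ0 hκ.2
  have hC : 0 ≤ C := by simpa using (hR 0).1.trans (hR 0).2
  refine ⟨C * K * K + 1, by positivity, fun t ht x => ?_⟩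
  have hS : 0 < (1 + ‖x‖ + Real.sqrt t) ^ (-κ) := by positivity
  have hpt : ∀ r ∈ Ioc (0 : ℝ) t, (∫ z₁, ∫ z₂,
      heatKernel d r (z₁ - x) * heatKernel d (t - r) z₂ * R (z₁ - z₂))
        ≤ C * K * K * (1 + ‖x‖ + Real.sqrt t) ^ (-κ) := by
    rintro r ⟨hr0, hrt⟩
    rcases hrt.eq_or_lt with rfl | hlt
    · have hz : ∀ z : EuclideanSpace ℝ (Fin d), heatKernel d 0 z = 0 := by
        intro z
        have : (-(d : ℝ) / 2) ≠ 0 := by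
          have : (1 : ℝ) ≤ d := by exact_mod_cast hd
          linarith
        simp [heatKernel, Real.zero_rpow this]
      simp only [sub_self, hz, mul_zero, zero_mul, integral_zero]
      positivity
    · have hs : 0 < t - r := by linarith
      set a : ℝ := 1 + Real.sqrt (t - r) with ha
      have ha0 : 0 < a := by positivity
      have hin : ∀ z₁ : EuclideanSpace ℝ (Fin d),
          ∫ z₂, heatKernel d r (z₁ - x) * heatKernel d (t - r) z₂ * R (z₁ - z₂)
          ≤ C * K * (heatKernel d r (z₁ - x) * (a + ‖-x - (z₁ - x)‖) ^ (-κ)) := by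
        intro z₁
        have hP := heat_nonneg d r hr0.le (z₁ - x)
        calc _ ≤ ∫ z₂, (heatKernel d r (z₁ - x) * C) *
              (heatKernel d (t - r) z₂ * (1 + ‖z₁ - z₂‖) ^ (-κ)) := by
              refine integral_mono_of_nonneg (Filter.Eventually.of_forall fun z => ?_)
                ((aux_int d κ hκ0 (t - r) 1 hs one_pos z₁).const_mul _)
                (Filter.Eventually.of_forall fun z => ?_)
              · exact mul_nonneg (mul_nonneg hP (heat_nonneg d _ hs.le z)) (hR _).1
              · have hQ := heat_nonneg d _ hs.le z
                calc _ ≤ heatKernel d r (z₁ - x) * heatKernel d (t - r) z *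
                      (C * (1 + ‖z₁ - z‖) ^ (-κ)) := by
                      exact mul_le_mul_of_nonneg_left (hR _).2 (mul_nonneg hP hQ)
                  _ = _ := by ring
          _ = (heatKernel d r (z₁ - x) * C) *
              ∫ z₂, (heatKernel d (t - r) z₂ * (1 + ‖z₁ - z₂‖) ^ (-κ)) := integral_const_mul _ _
          _ ≤ (heatKernel d r (z₁ - x) * C) * (K * (1 + ‖z₁‖ + Real.sqrt (t - r)) ^ (-κ)) := by
              gcongr
              exact H (t - r) hs 1 one_pos z₁
          _ = _ := by
              have e1 : -x - (z₁ - x) = -z₁ := by abel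
              have e2 : 1 + ‖z₁‖ + Real.sqrt (t - r) = a + ‖z₁‖ := by rw [ha]; ring
              rw [e1, norm_neg, e2]; ring
      have hI : Integrable (fun z₁ : EuclideanSpace ℝ (Fin d) =>
          heatKernel d r (z₁ - x) * (a + ‖-x - (z₁ - x)‖) ^ (-κ)) :=
        (aux_int d κ hκ0 r a hr0 ha0 (-x)).comp_sub_right x
      calc _ ≤ ∫ z₁, C * K * (heatKernel d r (z₁ - x) * (a + ‖-x - (z₁ - x)‖) ^ (-κ)) := by
            refine integral_mono_of_nonneg (Filter.Eventually.of_forall fun z => ?_)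
              (hI.const_mul _) (Filter.Eventually.of_forall hin)
            exact integral_nonneg fun w => mul_nonneg (mul_nonneg (heat_nonneg d _ hr0.le _)
              (heat_nonneg d _ hs.le _)) (hR _).1
        _ = C * K * ∫ z, heatKernel d r z * (a + ‖-x - z‖) ^ (-κ) := by
            rw [integral_const_mul, integral_sub_right_eq_self
              (fun z => heatKernel d r z * (a + ‖-x - z‖) ^ (-κ)) x]
        _ ≤ C * K * (K * (a + ‖-x‖ + Real.sqrt r) ^ (-κ)) := by
            gcongr
            exact H r hr0 a ha0 (-x)
        _ ≤ C * K * (K * (1 + ‖x‖ + Real.sqrt t) ^ (-κ)) := by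
            have h1 : Real.sqrt t ≤ Real.sqrt (t - r) + Real.sqrt r := by
              rw [Real.sqrt_le_left (by positivity)]
              nlinarith [Real.sq_sqrt hs.le, Real.sq_sqrt hr0.le,
                mul_nonneg (Real.sqrt_nonneg (t - r)) (Real.sqrt_nonneg r)]
            gcongr C * K * (K * ?_)
            refine Real.rpow_le_rpow_of_nonpos (by positivity) ?_ (by linarith)
            rw [norm_neg]; linarith
        _ = _ := by ring
  calc _ ≤ ∫ r in Set.Ioc (0 : ℝ) t, C * K * K * (1 + ‖x‖ + Real.sqrt t) ^ (-κ) := by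
        refine integral_mono_of_nonneg ?_ (integrable_const _) ?_
        · refine (ae_restrict_iff' measurableSet_Ioc).2 (Filter.Eventually.of_forall fun r hr => ?_)
          exact integral_nonneg fun z => integral_nonneg fun w => mul_nonneg (mul_nonneg
            (heat_nonneg d _ hr.1.le _) (heat_nonneg d _ (sub_nonneg.2 hr.2) _)) (hR _).1
        · exact (ae_restrict_iff' measurableSet_Ioc).2 (Filter.Eventually.of_forall hpt)
    _ = C * K * K * t * (1 + ‖x‖ + Real.sqrt t) ^ (-κ) := by
        simp [ht.le]; ring
    _ ≤ _ := by nlinarith [mul_pos ht hS]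
end
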